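/- arXiv:2303.16806 — 3 statements merged into one kernel-verified Lean document; each statement's English description precedes it below -/
import Mathlib

section
/- For every 2-player stage game G with |V₁^{p,p}| > 1 and |V₂^{p,p}| > 1: if G ∈ 𝒢_LS^{m,p} (local suboptimality occurs in some SPE of some G(T) when player 1 may use mixed strategies and player 2 only pure strategies), then G ∈ 𝒢_LS^{p,p} (local suboptimality occurs in some SPE of some G(T) when both players use only pure strategies). -/
open Finset

/-- A mixed strategy on a finite action set: a probability distribution. -/
structure Mix (A : Type*) [Fintype A] where
  p : A → ℝ
  nonneg : ∀ a, 0 ≤ p a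
  sum_one : ∑ a, p a = 1

namespace Mix

/-- The Dirac (pure) mixed strategy at an action. -/
def pure {A : Type*} [Fintype A] [DecidableEq A] (a : A) : Mix A where
  p := fun b => if b = a then 1 else 0
  nonneg := by intro b; by_cases hb : b = a <;> simp [hb]
  sum_one := by simp

/-- The support of a mixed strategy. -/
def support {A : Type*} [Fintype A] (σ : Mix A) : Set A := {a | 0 < σ.p a}

end Mix

section TwoPlayer

variable {A₁ A₂ : Type*} [Fintype A₁] [Fintype A₂] [DecidableEq A₁] [DecidableEq A₂]

/-- Expected payoff under a mixed strategy profile. -/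
def expPay (u : A₁ → A₂ → ℝ) (σ₁ : Mix A₁) (σ₂ : Mix A₂) : ℝ :=
  ∑ a₁, ∑ a₂, σ₁.p a₁ * σ₂.p a₂ * u a₁ a₂

/-- Player 1's pure action `a₁` is a best response among pure strategies to `a₂`. -/
def BR1p (u₁ : A₁ → A₂ → ℝ) (a₁ : A₁) (a₂ : A₂) : Prop := ∀ b₁, u₁ b₁ a₂ ≤ u₁ a₁ a₂

/-- Player 2's pure action `a₂` is a best response among pure strategies to `a₁`. -/
def BR2p (u₂ : A₁ → A₂ → ℝ) (a₁ : A₁) (a₂ : A₂) : Prop := ∀ b₂, u₂ a₁ b₂ ≤ u₂ a₁ a₂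

/-- Player 1's mixed strategy `σ₁` is a best response (among mixed strategies) to `σ₂`. -/
def BR1m (u₁ : A₁ → A₂ → ℝ) (σ₁ : Mix A₁) (σ₂ : Mix A₂) : Prop :=
  ∀ τ₁ : Mix A₁, expPay u₁ τ₁ σ₂ ≤ expPay u₁ σ₁ σ₂

/-- Player 2's mixed strategy `σ₂` is a best response (among mixed strategies) to `σ₁`. -/
def BR2m (u₂ : A₁ → A₂ → ℝ) (σ₁ : Mix A₁) (σ₂ : Mix A₂) : Prop :=
  ∀ τ₂ : Mix A₂, expPay u₂ σ₁ τ₂ ≤ expPay u₂ σ₁ σ₂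

/-- Player 2's pure action `a₂` is a best response among pure strategies to mixed `σ₁`. -/
def BR2pm (u₂ : A₁ → A₂ → ℝ) (σ₁ : Mix A₁) (a₂ : A₂) : Prop :=
  ∀ b₂ : A₂, expPay u₂ σ₁ (Mix.pure b₂) ≤ expPay u₂ σ₁ (Mix.pure a₂)

/-- Pure Nash equilibria (both players restricted to pure strategies). -/
def NashPP (u₁ u₂ : A₁ → A₂ → ℝ) : Set (A₁ × A₂) :=
  {q | BR1p u₁ q.1 q.2 ∧ BR2p u₂ q.1 q.2}

/-- Nash equilibria when player 1 is mixed and player 2 is pure. -/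
def NashMP (u₁ u₂ : A₁ → A₂ → ℝ) : Set (Mix A₁ × A₂) :=
  {q | BR1m u₁ q.1 (Mix.pure q.2) ∧ BR2pm u₂ q.1 q.2}

/-- Mixed Nash equilibria. -/
def NashMM (u₁ u₂ : A₁ → A₂ → ℝ) : Set (Mix A₁ × Mix A₂) :=
  {q | BR1m u₁ q.1 q.2 ∧ BR2m u₂ q.1 q.2}

def V1pp (u₁ u₂ : A₁ → A₂ → ℝ) : Set ℝ := (fun q => u₁ q.1 q.2) '' NashPP u₁ u₂
def V2pp (u₁ u₂ : A₁ → A₂ → ℝ) : Set ℝ := (fun q => u₂ q.1 q.2) '' NashPP u₁ u₂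
def V1mp (u₁ u₂ : A₁ → A₂ → ℝ) : Set ℝ :=
  (fun q => expPay u₁ q.1 (Mix.pure q.2)) '' NashMP u₁ u₂
def V2mp (u₁ u₂ : A₁ → A₂ → ℝ) : Set ℝ :=
  (fun q => expPay u₂ q.1 (Mix.pure q.2)) '' NashMP u₁ u₂
def V1mm (u₁ u₂ : A₁ → A₂ → ℝ) : Set ℝ := (fun q => expPay u₁ q.1 q.2) '' NashMM u₁ u₂
def V2mm (u₁ u₂ : A₁ → A₂ → ℝ) : Set ℝ := (fun q => expPay u₂ q.1 q.2) '' NashMM u₁ u₂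

/-- The set `V` is a singleton, i.e. `|V| = 1`. -/
def oneVal (V : Set ℝ) : Prop := ∃ v, V = {v}

/-- A history of play: a finite sequence of pure action profiles. -/
abbrev Hist (A₁ A₂ : Type*) := List (A₁ × A₂)

/-- A pure behavior strategy for player 1, seen as a mixed behavior strategy. -/
def pureBeh1 (μ : Hist A₁ A₂ → A₁) : Hist A₁ A₂ → Mix A₁ := fun h => Mix.pure (μ h)

/-- A pure behavior strategy for player 2, seen as a mixed behavior strategy. -/
def pureBeh2 (μ : Hist A₁ A₂ → A₂) : Hist A₁ A₂ → Mix A₂ := fun h => Mix.pure (μ h)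

/-- Expected total payoff (w.r.t. `u`) over `T` remaining rounds, after history `h`. -/
def totPay (u : A₁ → A₂ → ℝ) (μ₁ : Hist A₁ A₂ → Mix A₁) (μ₂ : Hist A₁ A₂ → Mix A₂) :
    ℕ → Hist A₁ A₂ → ℝ
  | 0, _ => 0
  | T + 1, h =>
      ∑ a₁, ∑ a₂, (μ₁ h).p a₁ * (μ₂ h).p a₂ * (u a₁ a₂ + totPay u μ₁ μ₂ T (h ++ [(a₁, a₂)]))

/-- The behavior strategy induced on the subgame following history `h`. -/
def condS {A₁ A₂ α : Type*} (μ : Hist A₁ A₂ → α) (h : Hist A₁ A₂) : Hist A₁ A₂ → α :=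
  fun h' => μ (h ++ h')

/-- Nash equilibrium of the `T`-round repeated game, both players mixed. -/
def isNEmm (u₁ u₂ : A₁ → A₂ → ℝ) (T : ℕ)
    (μ₁ : Hist A₁ A₂ → Mix A₁) (μ₂ : Hist A₁ A₂ → Mix A₂) : Prop :=
  (∀ μ₁' : Hist A₁ A₂ → Mix A₁, totPay u₁ μ₁' μ₂ T [] ≤ totPay u₁ μ₁ μ₂ T []) ∧
  (∀ μ₂' : Hist A₁ A₂ → Mix A₂, totPay u₂ μ₁ μ₂' T [] ≤ totPay u₂ μ₁ μ₂ T [])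

/-- Subgame-perfect equilibrium of the `T`-round repeated game, both players mixed. -/
def isSPEmm (u₁ u₂ : A₁ → A₂ → ℝ) (T : ℕ)
    (μ₁ : Hist A₁ A₂ → Mix A₁) (μ₂ : Hist A₁ A₂ → Mix A₂) : Prop :=
  ∀ h : Hist A₁ A₂, h.length < T → isNEmm u₁ u₂ (T - h.length) (condS μ₁ h) (condS μ₂ h)

/-- Nash equilibrium of the `T`-round repeated game, player 1 mixed and player 2 pure. -/
def isNEmp (u₁ u₂ : A₁ → A₂ → ℝ) (T : ℕ)
    (μ₁ : Hist A₁ A₂ → Mix A₁) (μ₂ : Hist A₁ A₂ → A₂) : Prop :=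
  (∀ μ₁' : Hist A₁ A₂ → Mix A₁,
      totPay u₁ μ₁' (pureBeh2 μ₂) T [] ≤ totPay u₁ μ₁ (pureBeh2 μ₂) T []) ∧
  (∀ μ₂' : Hist A₁ A₂ → A₂,
      totPay u₂ μ₁ (pureBeh2 μ₂') T [] ≤ totPay u₂ μ₁ (pureBeh2 μ₂) T [])

/-- SPE of the `T`-round repeated game, player 1 mixed and player 2 pure. -/
def isSPEmp (u₁ u₂ : A₁ → A₂ → ℝ) (T : ℕ)
    (μ₁ : Hist A₁ A₂ → Mix A₁) (μ₂ : Hist A₁ A₂ → A₂) : Prop :=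
  ∀ h : Hist A₁ A₂, h.length < T → isNEmp u₁ u₂ (T - h.length) (condS μ₁ h) (condS μ₂ h)

/-- Nash equilibrium of the `T`-round repeated game, both players pure. -/
def isNEpp (u₁ u₂ : A₁ → A₂ → ℝ) (T : ℕ)
    (μ₁ : Hist A₁ A₂ → A₁) (μ₂ : Hist A₁ A₂ → A₂) : Prop :=
  (∀ μ₁' : Hist A₁ A₂ → A₁,
      totPay u₁ (pureBeh1 μ₁') (pureBeh2 μ₂) T [] ≤
        totPay u₁ (pureBeh1 μ₁) (pureBeh2 μ₂) T []) ∧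
  (∀ μ₂' : Hist A₁ A₂ → A₂,
      totPay u₂ (pureBeh1 μ₁) (pureBeh2 μ₂') T [] ≤
        totPay u₂ (pureBeh1 μ₁) (pureBeh2 μ₂) T [])

/-- SPE of the `T`-round repeated game, both players pure. -/
def isSPEpp (u₁ u₂ : A₁ → A₂ → ℝ) (T : ℕ)
    (μ₁ : Hist A₁ A₂ → A₁) (μ₂ : Hist A₁ A₂ → A₂) : Prop :=
  ∀ h : Hist A₁ A₂, h.length < T → isNEpp u₁ u₂ (T - h.length) (condS μ₁ h) (condS μ₂ h)

/-- `G ∈ 𝒢_LS^{p,p}`: local suboptimality occurs in some SPE of some `G(T)`,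
both players restricted to pure strategies. -/
def GLSpp (u₁ u₂ : A₁ → A₂ → ℝ) : Prop :=
  ∃ T : ℕ, 1 ≤ T ∧ ∃ (μ₁ : Hist A₁ A₂ → A₁) (μ₂ : Hist A₁ A₂ → A₂),
    isSPEpp u₁ u₂ T μ₁ μ₂ ∧ ∃ h : Hist A₁ A₂, h.length < T ∧ (μ₁ h, μ₂ h) ∉ NashPP u₁ u₂

/-- `G ∈ 𝒢_LS^{m,p}`: local suboptimality occurs in some SPE of some `G(T)`,
player 1 mixed and player 2 pure. -/
def GLSmp (u₁ u₂ : A₁ → A₂ → ℝ) : Prop :=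
  ∃ T : ℕ, 1 ≤ T ∧ ∃ (μ₁ : Hist A₁ A₂ → Mix A₁) (μ₂ : Hist A₁ A₂ → A₂),
    isSPEmp u₁ u₂ T μ₁ μ₂ ∧ ∃ h : Hist A₁ A₂, h.length < T ∧ (μ₁ h, μ₂ h) ∉ NashMP u₁ u₂

/-- `G ∈ 𝒢_LS^{m,m}`: local suboptimality occurs in some SPE of some `G(T)`,
both players mixed. -/
def GLSmm (u₁ u₂ : A₁ → A₂ → ℝ) : Prop :=
  ∃ T : ℕ, 1 ≤ T ∧ ∃ (μ₁ : Hist A₁ A₂ → Mix A₁) (μ₂ : Hist A₁ A₂ → Mix A₂),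
    isSPEmm u₁ u₂ T μ₁ μ₂ ∧ ∃ h : Hist A₁ A₂, h.length < T ∧ (μ₁ h, μ₂ h) ∉ NashMM u₁ u₂

/-- The pure-pure characterization condition (condition of the pure-strategy theorem). -/
def condPP (u₁ u₂ : A₁ → A₂ → ℝ) : Prop :=
  ((V1pp u₁ u₂).Nontrivial ∧ (V2pp u₁ u₂).Nontrivial ∧
    ∃ (a₁ : A₁) (a₂ : A₂), (a₁, a₂) ∉ NashPP u₁ u₂) ∨
  ((V1pp u₁ u₂).Nontrivial ∧ oneVal (V2pp u₁ u₂) ∧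
    ∃ (a₁ a₁' : A₁) (a₂ : A₂), u₁ a₁ a₂ < u₁ a₁' a₂ ∧ BR2p u₂ a₁ a₂) ∨
  (oneVal (V1pp u₁ u₂) ∧ (V2pp u₁ u₂).Nontrivial ∧
    ∃ (a₁ : A₁) (a₂ a₂' : A₂), u₂ a₁ a₂ < u₂ a₁ a₂' ∧ BR1p u₁ a₁ a₂)

/-- The mixed-mixed characterization condition (condition of the general-case theorem). -/
def condMM (u₁ u₂ : A₁ → A₂ → ℝ) : Prop :=
  ((V1mm u₁ u₂).Nontrivial ∧ (V2mm u₁ u₂).Nontrivial ∧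
    ∃ (σ₁ : Mix A₁) (σ₂ : Mix A₂), (σ₁, σ₂) ∉ NashMM u₁ u₂) ∨
  ((V1mm u₁ u₂).Nontrivial ∧ oneVal (V2mm u₁ u₂) ∧
    ∃ (σ₁ : Mix A₁) (σ₂ : Mix A₂) (a₁' : A₁),
      expPay u₁ σ₁ σ₂ < expPay u₁ (Mix.pure a₁') σ₂ ∧ BR2m u₂ σ₁ σ₂) ∨
  (oneVal (V1mm u₁ u₂) ∧ (V2mm u₁ u₂).Nontrivial ∧
    ∃ (σ₁ : Mix A₁) (σ₂ : Mix A₂) (a₂' : A₂),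
      expPay u₂ σ₁ σ₂ < expPay u₂ σ₁ (Mix.pure a₂') ∧ BR1m u₁ σ₁ σ₂)

/-- The set `D` of differences of player 1's payoffs between pairs of stage-game
Nash equilibria (mixed-pure case). -/
def Dmp (u₁ u₂ : A₁ → A₂ → ℝ) : Set ℝ :=
  {x | ∃ q ∈ NashMP u₁ u₂, ∃ q' ∈ NashMP u₁ u₂,
    x = expPay u₁ q.1 (Mix.pure q.2) - expPay u₁ q'.1 (Mix.pure q'.2)}

/-- `x` is a finite (possibly empty) sum of elements of `D`. -/
def sumOfD (D : Set ℝ) (x : ℝ) : Prop :=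
  ∃ (n : ℕ) (d : Fin n → ℝ), (∀ k, d k ∈ D) ∧ x = ∑ k, d k

/-- The mixed-pure characterization condition (condition of the
pure-strategy-against-mixed-strategy theorem). -/
def condMP (u₁ u₂ : A₁ → A₂ → ℝ) : Prop :=
  ((V1mp u₁ u₂).Nontrivial ∧ (V2mp u₁ u₂).Nontrivial ∧
    ∃ (σ₁ : Mix A₁) (a₂ : A₂), (σ₁, a₂) ∉ NashMP u₁ u₂) ∨
  ((V1mp u₁ u₂).Nontrivial ∧ oneVal (V2mp u₁ u₂) ∧
    ∃ (σ₁ : Mix A₁) (a₁' : A₁) (a₂ : A₂),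
      expPay u₁ σ₁ (Mix.pure a₂) < u₁ a₁' a₂ ∧
      BR2pm u₂ σ₁ a₂ ∧
      (σ₁.support.Nontrivial →
        ∃ a ∈ σ₁.support, ∀ a' ∈ σ₁.support, a' ≠ a →
          sumOfD (Dmp u₁ u₂) (u₁ a a₂ - u₁ a' a₂))) ∨
  (oneVal (V1mp u₁ u₂) ∧ (V2mp u₁ u₂).Nontrivial ∧
    ∃ (σ₁ : Mix A₁) (a₂ a₂' : A₂),
      expPay u₂ σ₁ (Mix.pure a₂) < expPay u₂ σ₁ (Mix.pure a₂') ∧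
      BR1m u₁ σ₁ (Mix.pure a₂))

/-- A history is reachable under the behavior profile `(μ₁, μ₂)` (mixed-pure case):
every action of player 1 along it has positive probability and every action of
player 2 along it is the prescribed one. -/
def reachableMP (μ₁ : Hist A₁ A₂ → Mix A₁) (μ₂ : Hist A₁ A₂ → A₂) (h : Hist A₁ A₂) : Prop :=
  ∀ k : Fin h.length, 0 < (μ₁ (h.take k.val)).p (h.get k).1 ∧ μ₂ (h.take k.val) = (h.get k).2

end TwoPlayer

section TwoPlayer
variable {A₁ A₂ : Type*} [Fintype A₁] [Fintype A₂] [DecidableEq A₂]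

theorem expPay_pure_right (u : A₁ → A₂ → ℝ) (σ : Mix A₁) (a₂ : A₂) :
    expPay u σ (Mix.pure a₂) = ∑ a₁, σ.p a₁ * u a₁ a₂ := by
  simp [expPay, Mix.pure]

/-- If every pure profile is a Nash equilibrium, so is every mixed-pure profile. -/
theorem mem_NashMP_of_forall_mem_NashPP {u₁ u₂ : A₁ → A₂ → ℝ}
    (hall : ∀ q, q ∈ NashPP u₁ u₂) (q : Mix A₁ × A₂) : q ∈ NashMP u₁ u₂ := by
  obtain ⟨σ, a₂⟩ := q
  refine ⟨fun τ => ?_, fun b₂ => ?_⟩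
  · have hconst (ρ : Mix A₁) (b : A₁) : ∑ a, ρ.p a * u₁ a a₂ = u₁ b a₂ := by
      have h (a : A₁) : u₁ a a₂ = u₁ b a₂ := le_antisymm ((hall (b, a₂)).1 a) ((hall (a, a₂)).1 b)
      simp only [h, ← Finset.sum_mul, ρ.sum_one, one_mul]
    rw [expPay_pure_right, expPay_pure_right]
    obtain ⟨b⟩ : Nonempty A₁ := by
      by_contra hempty
      rw [not_nonempty_iff] at hempty
      simpa using σ.sum_one
    rw [hconst τ b, hconst σ b]
  · rw [expPay_pure_right, expPay_pure_right]
    exact Finset.sum_le_sum fun a _ =>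
      mul_le_mul_of_nonneg_left ((hall (a, a₂)).2 b₂) (σ.nonneg a)

variable [DecidableEq A₁]

theorem totPay_pureBeh_succ (u : A₁ → A₂ → ℝ) (f : Hist A₁ A₂ → A₁) (g : Hist A₁ A₂ → A₂)
    (T : ℕ) (h : Hist A₁ A₂) :
    totPay u (pureBeh1 f) (pureBeh2 g) (T + 1) h =
      u (f h) (g h) + totPay u (pureBeh1 f) (pureBeh2 g) T (h ++ [(f h, g h)]) := by
  simp [totPay, pureBeh1, pureBeh2, Mix.pure]

theorem totPay_pureBeh_le {u : A₁ → A₂ → ℝ} {f : Hist A₁ A₂ → A₁} {g : Hist A₁ A₂ → A₂}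
    {c : ℕ → ℝ} (T : ℕ) (h : Hist A₁ A₂)
    (hc : ∀ t, u (f (h ++ t)) (g (h ++ t)) ≤ c t.length) :
    totPay u (pureBeh1 f) (pureBeh2 g) T h ≤ ∑ k ∈ Finset.range T, c k := by
  induction T generalizing h c with
  | zero => simp [totPay]
  | succ T ih =>
    rw [totPay_pureBeh_succ, Finset.sum_range_succ', add_comm]
    refine add_le_add (ih (c := fun k => c (k + 1)) _ fun t => ?_) ?_
    · simpa using hc ((f h, g h) :: t)
    · simpa using hc []

theorem totPay_pureBeh_eq {u : A₁ → A₂ → ℝ} {f : Hist A₁ A₂ → A₁} {g : Hist A₁ A₂ → A₂}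
    {c : ℕ → ℝ} (T : ℕ) (h : Hist A₁ A₂)
    (hc : ∀ t, u (f (h ++ t)) (g (h ++ t)) = c t.length) :
    totPay u (pureBeh1 f) (pureBeh2 g) T h = ∑ k ∈ Finset.range T, c k := by
  induction T generalizing h c with
  | zero => simp [totPay]
  | succ T ih =>
    rw [totPay_pureBeh_succ, Finset.sum_range_succ', add_comm]
    congr 1
    · refine ih (c := fun k => c (k + 1)) _ fun t => ?_
      simpa using hc ((f h, g h) :: t)
    · simpa using hc []

/-- The plan that plays `a` first and then, if `q` was the outcome of the first round,
follows the sequence `e q`. -/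
def twoPhase {B α : Type*} (a : α) (e : B → ℕ → α) : List B → α
  | [] => a
  | q :: t => e q t.length

/-- A first-round profile followed by stage equilibria chosen according to the outcome of the
first round is subgame perfect as soon as no deviation in the first round is profitable. -/
theorem isSPEpp_twoPhase {u₁ u₂ : A₁ → A₂ → ℝ} {a₁ : A₁} {a₂ : A₂}
    {e : A₁ × A₂ → ℕ → A₁ × A₂} (he : ∀ q k, e q k ∈ NashPP u₁ u₂) (N : ℕ)
    (h₁ : ∀ b, u₁ b a₂ + ∑ k ∈ Finset.range N, u₁ (e (b, a₂) k).1 (e (b, a₂) k).2 ≤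
      u₁ a₁ a₂ + ∑ k ∈ Finset.range N, u₁ (e (a₁, a₂) k).1 (e (a₁, a₂) k).2)
    (h₂ : ∀ b, u₂ a₁ b + ∑ k ∈ Finset.range N, u₂ (e (a₁, b) k).1 (e (a₁, b) k).2 ≤
      u₂ a₁ a₂ + ∑ k ∈ Finset.range N, u₂ (e (a₁, a₂) k).1 (e (a₁, a₂) k).2) :
    isSPEpp u₁ u₂ (N + 1) (twoPhase a₁ fun q k => (e q k).1)
      (twoPhase a₂ fun q k => (e q k).2) := by
  rintro (_ | ⟨q, s⟩) -
  · have hself (u : A₁ → A₂ → ℝ) :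
        totPay u (pureBeh1 (twoPhase a₁ fun q k => (e q k).1))
          (pureBeh2 (twoPhase a₂ fun q k => (e q k).2)) (N + 1) [] =
        u a₁ a₂ + ∑ k ∈ Finset.range N, u (e (a₁, a₂) k).1 (e (a₁, a₂) k).2 := by
      rw [totPay_pureBeh_succ]
      congr 1
      exact totPay_pureBeh_eq (c := fun k => u (e (a₁, a₂) k).1 (e (a₁, a₂) k).2) _ _
        fun t => rfl
    refine ⟨fun f => ?_, fun g => ?_⟩
    · change totPay u₁ (pureBeh1 f) (pureBeh2 (twoPhase a₂ fun q k => (e q k).2)) (N + 1) [] ≤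
        totPay u₁ (pureBeh1 (twoPhase a₁ fun q k => (e q k).1))
          (pureBeh2 (twoPhase a₂ fun q k => (e q k).2)) (N + 1) []
      rw [hself, totPay_pureBeh_succ]
      refine le_trans (add_le_add le_rfl ?_) (h₁ (f []))
      exact totPay_pureBeh_le
        (c := fun k => u₁ (e (f [], a₂) k).1 (e (f [], a₂) k).2) _ _
        fun t => (he (f [], a₂) t.length).1 _
    · change totPay u₂ (pureBeh1 (twoPhase a₁ fun q k => (e q k).1)) (pureBeh2 g) (N + 1) [] ≤
        totPay u₂ (pureBeh1 (twoPhase a₁ fun q k => (e q k).1))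
          (pureBeh2 (twoPhase a₂ fun q k => (e q k).2)) (N + 1) []
      rw [hself, totPay_pureBeh_succ]
      refine le_trans (add_le_add le_rfl ?_) (h₂ (g []))
      exact totPay_pureBeh_le
        (c := fun k => u₂ (e (a₁, g []) k).1 (e (a₁, g []) k).2) _ _
        fun t => (he (a₁, g []) t.length).2 _
  · have hself (u : A₁ → A₂ → ℝ) (T : ℕ) := totPay_pureBeh_eq (u := u)
      (f := condS (twoPhase a₁ fun q k => (e q k).1) (q :: s))
      (g := condS (twoPhase a₂ fun q k => (e q k).2) (q :: s))
      (c := fun k => u (e q (s.length + k)).1 (e q (s.length + k)).2) T []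
      fun t => by simp [condS, twoPhase]
    refine ⟨fun f => ?_, fun g => ?_⟩
    · rw [hself]
      refine totPay_pureBeh_le _ _ fun t => ?_
      simpa [condS, twoPhase] using (he q (s.length + t.length)).1 (f t)
    · rw [hself]
      refine totPay_pureBeh_le _ _ fun t => ?_
      simpa [condS, twoPhase] using (he q (s.length + t.length)).2 (g t)

/-- If a real function takes two values on a finite set, then it has a minimizer there which is
not a maximizer. -/
theorem exists_minimizer_lt {α : Type*} [Finite α] {f : α → ℝ} {s : Set α}
    (hs : (f '' s).Nontrivial) : ∃ y ∈ s, (∀ q ∈ s, f y ≤ f q) ∧ ∃ x ∈ s, f y < f x := by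
  obtain ⟨y, hy, hmin⟩ := s.exists_min_image f s.toFinite hs.nonempty.of_image
  obtain ⟨_, ⟨x, hx, rfl⟩, hne⟩ := hs.exists_ne (f y)
  exact ⟨y, hy, hmin, x, hx, (hmin x hx).lt_of_ne hne.symm⟩

theorem sum_range_add_self_ite (K : ℕ) (x z : ℝ) :
    ∑ k ∈ Finset.range (K + K), (if k < K then x else z) = K * x + K * z := by
  rw [Finset.sum_range_add]
  congr 1
  · rw [Finset.sum_congr rfl fun k hk => if_pos (Finset.mem_range.1 hk)]
    simp
  · simp

/-- Playing `y` for `2K` rounds is a punishment when the reward consists of `K` rounds of `x` and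
`K` rounds of `z`. -/
theorem add_sum_const_le {K : ℕ} {d v x y z : ℝ} (hK : d - v ≤ K * (x - y)) (hz : y ≤ z) :
    d + ∑ _k ∈ Finset.range (K + K), y ≤ v + (K * x + K * z) := by
  have hKz : (K : ℝ) * y ≤ K * z := mul_le_mul_of_nonneg_left hz K.cast_nonneg
  rw [Finset.sum_const, Finset.card_range, nsmul_eq_mul]
  push_cast
  linarith

theorem eventually_le_natCast_mul {ι : Type*} [Finite ι] (f : ι → ℝ) {δ : ℝ} (hδ : 0 < δ) :
    ∀ᶠ K : ℕ in Filter.atTop, ∀ i, f i ≤ K * δ :=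
  Filter.eventually_all.2 fun i =>
    (tendsto_natCast_atTop_atTop.atTop_mul_const hδ).eventually_ge_atTop (f i)

/-- With two distinct equilibrium payoffs for each player, any profile which is not an
equilibrium can be sustained in the first round of a long enough repeated game. -/
theorem GLSpp_of_notMem_NashPP {u₁ u₂ : A₁ → A₂ → ℝ}
    (hV1 : (V1pp u₁ u₂).Nontrivial) (hV2 : (V2pp u₁ u₂).Nontrivial)
    {a₁ : A₁} {a₂ : A₂} (ha : (a₁, a₂) ∉ NashPP u₁ u₂) : GLSpp u₁ u₂ := by
  obtain ⟨y, hy, hymin, x, hx, hyx⟩ := exists_minimizer_lt hV1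
  obtain ⟨w, hw, hwmin, z, hz, hwz⟩ := exists_minimizer_lt hV2
  obtain ⟨K, hK₁, hK₂⟩ :=
    ((eventually_le_natCast_mul (fun b => u₁ b a₂ - u₁ a₁ a₂) (sub_pos.2 hyx)).and
      (eventually_le_natCast_mul (fun b => u₂ a₁ b - u₂ a₁ a₂) (sub_pos.2 hwz))).exists
  let e : A₁ × A₂ → ℕ → A₁ × A₂ := fun q k =>
    if q = (a₁, a₂) then (if k < K then x else z) else if q.1 = a₁ then w else y
  have he (q : A₁ × A₂) (k : ℕ) : e q k ∈ NashPP u₁ u₂ := by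
    simp only [e]
    split_ifs <;> assumption
  have hpath (u : A₁ → A₂ → ℝ) (k : ℕ) : u (e (a₁, a₂) k).1 (e (a₁, a₂) k).2 =
      if k < K then u x.1 x.2 else u z.1 z.2 := by
    simp only [e, if_true]
    split_ifs <;> rfl
  refine ⟨K + K + 1, by omega, _, _, isSPEpp_twoPhase he (K + K) (fun b => ?_) (fun b => ?_),
    [], by simp, ha⟩
  · by_cases hb : b = a₁
    · rw [hb]
    · have hdev (k : ℕ) : e (b, a₂) k = y := by simp [e, hb]
      simp only [hpath, hdev, sum_range_add_self_ite]
      exact add_sum_const_le (hK₁ b) (hymin z hz)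
  · by_cases hb : b = a₂
    · rw [hb]
    · have hdev (k : ℕ) : e (a₁, b) k = w := by simp [e, hb]
      simp only [hpath, hdev, sum_range_add_self_ite]
      rw [add_comm (_ * _)]
      exact add_sum_const_le (hK₂ b) (hwmin x hx)

end TwoPlayer

section TwoPlayer
variable {A₁ A₂ : Type*} [Fintype A₁] [Fintype A₂] [DecidableEq A₁] [DecidableEq A₂]
variable [Nonempty A₁] [Nonempty A₂]

/-- If `|V₁^{p,p}| > 1`, `|V₂^{p,p}| > 1`, and `G ∈ 𝒢_LS^{m,p}`, then `G ∈ 𝒢_LS^{p,p}`. -/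
theorem GLSpp_of_GLSmp (u₁ u₂ : A₁ → A₂ → ℝ)
    (hV1 : (V1pp u₁ u₂).Nontrivial) (hV2 : (V2pp u₁ u₂).Nontrivial)
    (h : GLSmp u₁ u₂) : GLSpp u₁ u₂ := by
  obtain ⟨_, _, _, _, _, _, _, hnot⟩ := h
  by_contra hpp
  exact hnot (mem_NashMP_of_forall_mem_NashPP
    (fun q => by_contra fun hq => hpp (GLSpp_of_notMem_NashPP hV1 hV2 hq)) _)

end TwoPlayer
end

section
/- For every 2-player stage game G: G ∉ 𝒢_LS^{p,p} and G ∈ 𝒢_LS^{m,p} if and only if at least one of the following holds: (1) |V₁^{p,p}| = 0, |V₂^{p,p}| = 0, and the sufficient-and-necessary condition of the mixed-pure characterization theorem holds for G; OR (2) |V₁^{p,p}| = 1, |V₂^{p,p}| = 1, and the mixed-pure characterization condition holds for G; OR (3) |V₁^{p,p}| > 1, |V₂^{p,p}| = 1, there do not exist â₁, a₁′ ∈ A₁ and â₂ ∈ A₂ with u₁(â₁, â₂) < u₁(a₁′, â₂) and â₂ a best response (among pure strategies) to â₁, and the mixed-pure characterization condition holds for G. -/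
open Finset

namespace Mix

variable {A : Type*} [Fintype A]

/-- The expectation of a function on actions under a mixed strategy. -/
def expect (σ : Mix A) (f : A → ℝ) : ℝ := ∑ a, σ.p a * f a

lemma expect_const (σ : Mix A) (c : ℝ) : σ.expect (fun _ => c) = c := by
  simp [expect, ← Finset.sum_mul, σ.sum_one]

lemma expect_add (σ : Mix A) (f g : A → ℝ) :
    σ.expect (fun a => f a + g a) = σ.expect f + σ.expect g := by
  simp [expect, mul_add, Finset.sum_add_distrib]

lemma expect_add_const (σ : Mix A) (f : A → ℝ) (c : ℝ) :
    σ.expect (fun a => f a + c) = σ.expect f + c := by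
  rw [expect_add, expect_const]

lemma expect_mono (σ : Mix A) {f g : A → ℝ} (h : ∀ a, f a ≤ g a) : σ.expect f ≤ σ.expect g :=
  Finset.sum_le_sum fun a _ => mul_le_mul_of_nonneg_left (h a) (σ.nonneg a)

lemma expect_le (σ : Mix A) {f : A → ℝ} {c : ℝ} (h : ∀ a, f a ≤ c) : σ.expect f ≤ c :=
  (σ.expect_mono h).trans_eq (σ.expect_const c)

lemma expect_congr (σ : Mix A) {f g : A → ℝ} (h : ∀ a ∈ σ.support, f a = g a) :
    σ.expect f = σ.expect g := by
  refine Finset.sum_congr rfl fun a _ => ?_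
  rcases (σ.nonneg a).eq_or_lt with h0 | h0
  · simp [← h0]
  · rw [h a h0]

lemma expect_eq_of_support (σ : Mix A) {f : A → ℝ} {c : ℝ} (h : ∀ a ∈ σ.support, f a = c) :
    σ.expect f = c :=
  (σ.expect_congr h).trans (σ.expect_const c)

lemma expect_pure [DecidableEq A] (a : A) (f : A → ℝ) : (Mix.pure a).expect f = f a := by
  simp [expect, Mix.pure]

lemma support_pure [DecidableEq A] (a : A) : (Mix.pure a).support = {a} := by
  ext b
  by_cases h : b = a <;> simp [support, Mix.pure, h]

lemma support_nonempty (σ : Mix A) : σ.support.Nonempty := by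
  by_contra h
  have h0 : ∀ a, σ.p a = 0 := fun a =>
    le_antisymm (not_lt.1 fun ha => h ⟨a, ha⟩) (σ.nonneg a)
  simpa [h0] using σ.sum_one

/-- If no value of `f` exceeds its expectation, then `f` is constant on the support. -/
lemma eq_expect_of_mem_support (σ : Mix A) {f : A → ℝ} (h : ∀ a, f a ≤ σ.expect f) {a : A}
    (ha : a ∈ σ.support) : f a = σ.expect f := by
  refine le_antisymm (h a) (not_lt.1 fun hlt => ?_)
  have : σ.expect f < σ.expect fun _ => σ.expect f :=
    Finset.sum_lt_sum (fun b _ => mul_le_mul_of_nonneg_left (h b) (σ.nonneg b))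
      ⟨a, Finset.mem_univ a, mul_lt_mul_of_pos_left hlt ha⟩
  rw [expect_const] at this
  exact this.false

end Mix

lemma exists_nat_forall_sub_le {I : Type*} [Finite I] (f : I → ℝ) {δ : ℝ} (hδ : 0 < δ) :
    ∃ N : ℕ, ∀ i j, f i - f j ≤ N * δ := by
  obtain ⟨C, hC⟩ := (Set.finite_range fun p : I × I => f p.1 - f p.2).bddAbove
  obtain ⟨N, hN⟩ := exists_nat_ge (C / δ)
  refine ⟨N, fun i j => ?_⟩
  have h1 : f i - f j ≤ C := hC ⟨(i, j), rfl⟩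
  have h2 := (div_le_iff₀ hδ).1 hN
  linarith

section StrategyClass

variable {A₁ A₂ X : Type*} [Fintype A₁] [Fintype A₂] [DecidableEq A₁] [DecidableEq A₂]

lemma expPay_pure_right_s10 (u : A₁ → A₂ → ℝ) (σ : Mix A₁) (b : A₂) :
    expPay u σ (Mix.pure b) = σ.expect fun a => u a b := by
  simp [expPay, Mix.expect, Mix.pure]

lemma expPay_pure_pure (u : A₁ → A₂ → ℝ) (a : A₁) (b : A₂) :
    expPay u (Mix.pure a) (Mix.pure b) = u a b := by
  rw [expPay_pure_right_s10, Mix.expect_pure]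

/-! ### Games in which player 1's strategies range over a class `X` of mixed strategies -/

/-- Stage payoff when player 1 uses `x : X`, read as a mixed strategy through `ι`. -/
def clsPay (ι : X → Mix A₁) (u : A₁ → A₂ → ℝ) (q : X × A₂) : ℝ :=
  expPay u (ι q.1) (Mix.pure q.2)

/-- Stage-game Nash equilibria with player 1 in the class `X` and player 2 pure. -/
def clsNash (ι : X → Mix A₁) (u₁ u₂ : A₁ → A₂ → ℝ) : Set (X × A₂) :=
  {q | (∀ y, clsPay ι u₁ (y, q.2) ≤ clsPay ι u₁ q) ∧ ∀ b, clsPay ι u₂ (q.1, b) ≤ clsPay ι u₂ q}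

/-- Total payoff when player 1's behavior strategy takes values in the class `X`. -/
def clsTot (ι : X → Mix A₁) (u : A₁ → A₂ → ℝ) (μ₁ : Hist A₁ A₂ → X) (μ₂ : Hist A₁ A₂ → A₂) :
    ℕ → Hist A₁ A₂ → ℝ :=
  totPay u (fun h => ι (μ₁ h)) (pureBeh2 μ₂)

/-- Subgame-perfect equilibria with player 1 in the class `X` and player 2 pure. -/
def clsSPE (ι : X → Mix A₁) (u₁ u₂ : A₁ → A₂ → ℝ) (T : ℕ)
    (μ₁ : Hist A₁ A₂ → X) (μ₂ : Hist A₁ A₂ → A₂) : Prop :=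
  ∀ h : Hist A₁ A₂, h.length < T →
    (∀ ν₁, clsTot ι u₁ ν₁ (condS μ₂ h) (T - h.length) [] ≤
      clsTot ι u₁ (condS μ₁ h) (condS μ₂ h) (T - h.length) []) ∧
    (∀ ν₂, clsTot ι u₂ (condS μ₁ h) ν₂ (T - h.length) [] ≤
      clsTot ι u₂ (condS μ₁ h) (condS μ₂ h) (T - h.length) [])

/-- Existence of a subgame-perfect equilibrium with local suboptimality. -/
def clsGLS (ι : X → Mix A₁) (u₁ u₂ : A₁ → A₂ → ℝ) : Prop :=
  ∃ T : ℕ, 1 ≤ T ∧ ∃ (μ₁ : Hist A₁ A₂ → X) (μ₂ : Hist A₁ A₂ → A₂),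
    clsSPE ι u₁ u₂ T μ₁ μ₂ ∧
      ∃ h : Hist A₁ A₂, h.length < T ∧ (μ₁ h, μ₂ h) ∉ clsNash ι u₁ u₂

/-- The differences of player 1's equilibrium payoffs. -/
def clsDiff (ι : X → Mix A₁) (u₁ u₂ : A₁ → A₂ → ℝ) : Set ℝ :=
  {d | ∃ q ∈ clsNash ι u₁ u₂, ∃ q' ∈ clsNash ι u₁ u₂, d = clsPay ι u₁ q - clsPay ι u₁ q'}

/-- The characterization condition for local suboptimality, for the class `X`. -/
def clsCond (ι : X → Mix A₁) (u₁ u₂ : A₁ → A₂ → ℝ) : Prop :=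
  ((clsPay ι u₁ '' clsNash ι u₁ u₂).Nontrivial ∧ (clsPay ι u₂ '' clsNash ι u₁ u₂).Nontrivial ∧
    ∃ (x : X) (b : A₂), (x, b) ∉ clsNash ι u₁ u₂) ∨
  ((clsPay ι u₁ '' clsNash ι u₁ u₂).Nontrivial ∧ oneVal (clsPay ι u₂ '' clsNash ι u₁ u₂) ∧
    ∃ (x : X) (a' : A₁) (b : A₂), clsPay ι u₁ (x, b) < u₁ a' b ∧
      (∀ b', clsPay ι u₂ (x, b') ≤ clsPay ι u₂ (x, b)) ∧
      ((ι x).support.Nontrivial →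
        ∃ a ∈ (ι x).support, ∀ a' ∈ (ι x).support, a' ≠ a →
          sumOfD (clsDiff ι u₁ u₂) (u₁ a b - u₁ a' b))) ∨
  (oneVal (clsPay ι u₁ '' clsNash ι u₁ u₂) ∧ (clsPay ι u₂ '' clsNash ι u₁ u₂).Nontrivial ∧
    ∃ (x : X) (b b' : A₂), clsPay ι u₂ (x, b) < clsPay ι u₂ (x, b') ∧
      ∀ y, clsPay ι u₁ (y, b) ≤ clsPay ι u₁ (x, b))

variable {ι : X → Mix A₁} {u u₁ u₂ : A₁ → A₂ → ℝ}
  {μ₁ : Hist A₁ A₂ → X} {μ₂ : Hist A₁ A₂ → A₂}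

lemma clsPay_eq_expect (x : X) (b : A₂) :
    clsPay ι u (x, b) = (ι x).expect fun a => u a b :=
  expPay_pure_right_s10 u (ι x) b

lemma clsPay_of_eq_pure {x : X} {a : A₁} (hx : ι x = Mix.pure a) (b : A₂) :
    clsPay ι u (x, b) = u a b := by
  rw [clsPay_eq_expect, hx, Mix.expect_pure]

lemma clsTot_succ (T : ℕ) (h : Hist A₁ A₂) :
    clsTot ι u μ₁ μ₂ (T + 1) h =
      (ι (μ₁ h)).expect fun a => u a (μ₂ h) + clsTot ι u μ₁ μ₂ T (h ++ [(a, μ₂ h)]) := by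
  simp [clsTot, totPay, Mix.expect, pureBeh2, Mix.pure]

lemma clsTot_condS (g : Hist A₁ A₂) (T : ℕ) (h : Hist A₁ A₂) :
    clsTot ι u (condS μ₁ g) (condS μ₂ g) T h = clsTot ι u μ₁ μ₂ T (g ++ h) := by
  induction T generalizing h with
  | zero => rfl
  | succ T ih => simp only [clsTot_succ, ih, condS, List.append_assoc]

lemma clsTot_congr {ν₁ : Hist A₁ A₂ → X} {ν₂ : Hist A₁ A₂ → A₂} (T : ℕ) (h : Hist A₁ A₂)
    (h₁ : ∀ g, μ₁ (h ++ g) = ν₁ (h ++ g)) (h₂ : ∀ g, μ₂ (h ++ g) = ν₂ (h ++ g)) :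
    clsTot ι u μ₁ μ₂ T h = clsTot ι u ν₁ ν₂ T h := by
  induction T generalizing h with
  | zero => rfl
  | succ T ih =>
    have e₁ : μ₁ h = ν₁ h := by simpa using h₁ []
    have e₂ : μ₂ h = ν₂ h := by simpa using h₂ []
    rw [clsTot_succ, clsTot_succ, e₁, e₂]
    congr 1
    funext a
    rw [ih]
    · intro g; simpa using h₁ ((a, ν₂ h) :: g)
    · intro g; simpa using h₂ ((a, ν₂ h) :: g)

lemma condS_drop {A₁ A₂ α : Type*} (ν : Hist A₁ A₂ → α) (h : Hist A₁ A₂) :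
    condS (fun g => ν (g.drop h.length)) h = ν := by
  funext g
  simp [condS]

/-- No player gains from deviating only in the round following `h`, when `T` rounds remain
after that round. -/
def OneShot (ι : X → Mix A₁) (u₁ u₂ : A₁ → A₂ → ℝ) (μ₁ : Hist A₁ A₂ → X)
    (μ₂ : Hist A₁ A₂ → A₂) (T : ℕ) (h : Hist A₁ A₂) : Prop :=
  (∀ y, (ι y).expect (fun a => u₁ a (μ₂ h) + clsTot ι u₁ μ₁ μ₂ T (h ++ [(a, μ₂ h)])) ≤
    (ι (μ₁ h)).expect fun a => u₁ a (μ₂ h) + clsTot ι u₁ μ₁ μ₂ T (h ++ [(a, μ₂ h)])) ∧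
  (∀ b, (ι (μ₁ h)).expect (fun a => u₂ a b + clsTot ι u₂ μ₁ μ₂ T (h ++ [(a, b)])) ≤
    (ι (μ₁ h)).expect fun a => u₂ a (μ₂ h) + clsTot ι u₂ μ₁ μ₂ T (h ++ [(a, μ₂ h)]))

/-- One-shot deviation principle. -/
lemma clsSPE_iff_oneShot {T : ℕ} :
    clsSPE ι u₁ u₂ T μ₁ μ₂ ↔
      ∀ (h : Hist A₁ A₂) (k : ℕ), h.length + (k + 1) = T → OneShot ι u₁ u₂ μ₁ μ₂ k h := by
  classical
  constructor
  · intro hS h k hk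
    obtain ⟨h₁, h₂⟩ := hS h (by omega)
    have hT : T - h.length = k + 1 := by omega
    rw [hT] at h₁ h₂
    constructor
    · intro y
      have := h₁ fun g => if g = [] then y else condS μ₁ h g
      rw [clsTot_condS, clsTot_succ, clsTot_succ] at this
      simp only [List.append_nil, if_true, List.nil_append] at this
      convert this using 4 with a
      · simp [condS]
      · rw [show condS μ₂ h [] = μ₂ h by simp [condS], ← clsTot_condS]
        exact clsTot_congr _ _ (by simp) (by simp)
    · intro b
      have := h₂ fun g => if g = [] then b else condS μ₂ h g
      rw [clsTot_condS, clsTot_succ, clsTot_succ] at this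
      simp only [List.append_nil, if_true, List.nil_append] at this
      convert this using 4 with a
      · simp [condS]
      · rw [← clsTot_condS]
        exact clsTot_congr _ _ (by simp) (by simp)
  · intro hO
    have key₁ : ∀ (ν₁ : Hist A₁ A₂ → X) (k : ℕ) (h : Hist A₁ A₂), h.length + k = T →
        clsTot ι u₁ ν₁ μ₂ k h ≤ clsTot ι u₁ μ₁ μ₂ k h := by
      intro ν₁ k
      induction k with
      | zero => intro h _; exact le_rfl
      | succ k ih =>
        intro h hk
        rw [clsTot_succ, clsTot_succ]
        refine le_trans (Mix.expect_mono _ fun a => ?_) ((hO h k hk).1 (ν₁ h))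
        gcongr
        exact ih _ (by simp; omega)
    have key₂ : ∀ (ν₂ : Hist A₁ A₂ → A₂) (k : ℕ) (h : Hist A₁ A₂), h.length + k = T →
        clsTot ι u₂ μ₁ ν₂ k h ≤ clsTot ι u₂ μ₁ μ₂ k h := by
      intro ν₂ k
      induction k with
      | zero => intro h _; exact le_rfl
      | succ k ih =>
        intro h hk
        rw [clsTot_succ, clsTot_succ]
        refine le_trans (Mix.expect_mono _ fun a => ?_) ((hO h k hk).2 (ν₂ h))
        gcongr
        exact ih _ (by simp; omega)
    intro h hh
    constructor
    · intro ν₁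
      rw [← condS_drop ν₁ h, clsTot_condS, clsTot_condS]
      exact key₁ _ _ _ (by simp; omega)
    · intro ν₂
      rw [← condS_drop ν₂ h, clsTot_condS, clsTot_condS]
      exact key₂ _ _ _ (by simp; omega)

lemma expect_eq_of_optimal (hι : ∀ a, ∃ x, ι x = Mix.pure a) {x : X} {f : A₁ → ℝ}
    (hx : ∀ y, (ι y).expect f ≤ (ι x).expect f) {a : A₁} (ha : a ∈ (ι x).support) :
    f a = (ι x).expect f := by
  refine Mix.eq_expect_of_mem_support _ (fun a' => ?_) ha
  obtain ⟨y, hy⟩ := hι a'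
  simpa [hy, Mix.expect_pure] using hx y

/-- When play is locally Nash from round `m` on, player 1's continuation payoffs are sums of
stage equilibrium payoffs. -/
lemma exists_clsTot_eq_sum (hι : ∀ a, ∃ x, ι x = Mix.pure a) {T m : ℕ}
    (hO : ∀ (h : Hist A₁ A₂) (k : ℕ), h.length + (k + 1) = T → OneShot ι u₁ u₂ μ₁ μ₂ k h)
    (hN : ∀ h : Hist A₁ A₂, m ≤ h.length → h.length < T → (μ₁ h, μ₂ h) ∈ clsNash ι u₁ u₂)
    (k : ℕ) (h : Hist A₁ A₂) (hm : m ≤ h.length) (hk : h.length + k = T) :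
    ∃ q : Fin k → X × A₂, (∀ i, q i ∈ clsNash ι u₁ u₂) ∧
      clsTot ι u₁ μ₁ μ₂ k h = ∑ i, clsPay ι u₁ (q i) := by
  induction k generalizing h with
  | zero => exact ⟨Fin.elim0, fun i => i.elim0, by simp [clsTot, totPay]⟩
  | succ k ih =>
    obtain ⟨a, ha⟩ := (ι (μ₁ h)).support_nonempty
    have hNash := hN h hm (by omega)
    have e₁ := expect_eq_of_optimal hι (hO h k hk).1 ha
    have e₂ : u₁ a (μ₂ h) = clsPay ι u₁ (μ₁ h, μ₂ h) := by
      have := hNash.1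
      simp only [clsPay_eq_expect] at this ⊢
      exact expect_eq_of_optimal hι this ha
    obtain ⟨q, hq, hs⟩ := ih (h ++ [(a, μ₂ h)]) (by simp; omega) (by simp; omega)
    refine ⟨Fin.cons (μ₁ h, μ₂ h) q, Fin.cases hNash hq, ?_⟩
    rw [clsTot_succ, ← e₁, Fin.sum_univ_succ, e₂, hs]
    simp

lemma clsTot_eq_of_pay_eq {T m : ℕ} {v : ℝ}
    (hv : ∀ h : Hist A₁ A₂, m ≤ h.length → h.length < T → clsPay ι u (μ₁ h, μ₂ h) = v)
    (k : ℕ) (h : Hist A₁ A₂) (hm : m ≤ h.length) (hk : h.length + k = T) :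
    clsTot ι u μ₁ μ₂ k h = k * v := by
  induction k generalizing h with
  | zero => simp [clsTot, totPay]
  | succ k ih =>
    have e : ∀ a, clsTot ι u μ₁ μ₂ k (h ++ [(a, μ₂ h)]) = k * v := fun a =>
      ih _ (by simp; omega) (by simp; omega)
    simp only [clsTot_succ, e, Mix.expect_add_const]
    rw [← clsPay_eq_expect, hv h hm (by omega)]
    push_cast; ring

lemma clsCond_of_clsGLS [Nonempty A₁] [Nonempty A₂] (hι : ∀ a, ∃ x, ι x = Mix.pure a)
    (H : clsGLS ι u₁ u₂) : clsCond ι u₁ u₂ := by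
  obtain ⟨T, hT, μ₁, μ₂, hS, hbad⟩ := H
  rw [clsSPE_iff_oneShot] at hS
  obtain ⟨h, ⟨hlen, hnot⟩, hmax⟩ := (measure fun h : Hist A₁ A₂ => T - h.length).wf.has_min
    {h | h.length < T ∧ (μ₁ h, μ₂ h) ∉ clsNash ι u₁ u₂} hbad
  have hN : ∀ g : Hist A₁ A₂, h.length + 1 ≤ g.length → g.length < T →
      (μ₁ g, μ₂ g) ∈ clsNash ι u₁ u₂ := by
    intro g h₁ h₂
    by_contra hg
    refine hmax g ⟨h₂, hg⟩ ?_
    change T - g.length < T - h.length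
    omega
  obtain ⟨q₀, hq₀⟩ : (clsNash ι u₁ u₂).Nonempty := by
    obtain ⟨a₀⟩ := ‹Nonempty A₁›
    obtain ⟨b₀⟩ := ‹Nonempty A₂›
    have := hS (List.replicate (T - 1) (a₀, b₀)) 0 (by simp; omega)
    refine ⟨(μ₁ (List.replicate (T - 1) (a₀, b₀)), μ₂ (List.replicate (T - 1) (a₀, b₀))), ?_⟩
    simpa [OneShot, clsNash, clsPay_eq_expect, clsTot, totPay] using this
  obtain ⟨k, hk⟩ : ∃ k, h.length + (k + 1) = T := ⟨T - h.length - 1, by omega⟩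
  obtain ⟨opt₁, opt₂⟩ := hS h k hk
  have const : ∀ {u : A₁ → A₂ → ℝ} {v : ℝ}, clsPay ι u '' clsNash ι u₁ u₂ = {v} →
      ∀ a b, clsTot ι u μ₁ μ₂ k (h ++ [(a, b)]) = k * v := by
    intro u v hv a b
    refine clsTot_eq_of_pay_eq (m := h.length + 1) (T := T) (fun g h₁ h₂ => ?_) _ _
      (by simp) (by simp; omega)
    exact (hv ▸ Set.mem_image_of_mem (clsPay ι u) (hN g h₁ h₂) : _ ∈ ({v} : Set ℝ))
  have br₁ : oneVal (clsPay ι u₁ '' clsNash ι u₁ u₂) →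
      ∀ y, clsPay ι u₁ (y, μ₂ h) ≤ clsPay ι u₁ (μ₁ h, μ₂ h) := by
    rintro ⟨v, hv⟩ y
    have := opt₁ y
    simp only [const hv, Mix.expect_add_const] at this
    simp only [clsPay_eq_expect]
    linarith
  have br₂ : oneVal (clsPay ι u₂ '' clsNash ι u₁ u₂) →
      ∀ b, clsPay ι u₂ (μ₁ h, b) ≤ clsPay ι u₂ (μ₁ h, μ₂ h) := by
    rintro ⟨v, hv⟩ b
    have := opt₂ b
    simp only [const hv, Mix.expect_add_const] at this
    simp only [clsPay_eq_expect]
    linarith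
  have hne : ∀ u : A₁ → A₂ → ℝ, oneVal (clsPay ι u '' clsNash ι u₁ u₂) ∨
      (clsPay ι u '' clsNash ι u₁ u₂).Nontrivial := fun u =>
    Set.Nonempty.exists_eq_singleton_or_nontrivial ⟨_, Set.mem_image_of_mem _ hq₀⟩
  rcases hne u₁ with h₁ | h₁ <;> rcases hne u₂ with h₂ | h₂
  · exact absurd ⟨br₁ h₁, br₂ h₂⟩ hnot
  · refine Or.inr (Or.inr ⟨h₁, h₂, μ₁ h, μ₂ h, ?_⟩)
    by_contra! hc
    exact hnot ⟨br₁ h₁, fun b => not_lt.1 fun hlt => by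
      obtain ⟨y, hy⟩ := hc b hlt
      exact (br₁ h₁ y).not_gt hy⟩
  · refine Or.inr (Or.inl ⟨h₁, h₂, μ₁ h, ?_⟩)
    obtain ⟨a', ha'⟩ : ∃ a', clsPay ι u₁ (μ₁ h, μ₂ h) < u₁ a' (μ₂ h) := by
      by_contra! hc
      exact hnot ⟨fun y => by rw [clsPay_eq_expect y]; exact Mix.expect_le _ hc, br₂ h₂⟩
    refine ⟨a', μ₂ h, ha', br₂ h₂, fun _ => ?_⟩
    obtain ⟨a, ha⟩ := (ι (μ₁ h)).support_nonempty
    refine ⟨a, ha, fun c hc _ => ?_⟩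
    have ea := expect_eq_of_optimal hι opt₁ ha
    have ec := expect_eq_of_optimal hι opt₁ hc
    have cont : ∀ a, ∃ q : Fin k → X × A₂, (∀ i, q i ∈ clsNash ι u₁ u₂) ∧
        clsTot ι u₁ μ₁ μ₂ k (h ++ [(a, μ₂ h)]) = ∑ i, clsPay ι u₁ (q i) := fun a =>
      exists_clsTot_eq_sum hι hS hN k _ (by simp) (by simp; omega)
    obtain ⟨q, hq, hqs⟩ := cont a
    obtain ⟨q', hq', hqs'⟩ := cont c
    refine ⟨k, fun i => clsPay ι u₁ (q' i) - clsPay ι u₁ (q i),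
      fun i => ⟨_, hq' i, _, hq i, rfl⟩, ?_⟩
    rw [Finset.sum_sub_distrib, ← hqs, ← hqs']
    linarith
  · exact Or.inl ⟨h₁, h₂, _, _, hnot⟩

/-- A non-equilibrium first round can be supported by a continuation that plays, in the rounds
`K` that follow, stage equilibria depending only on the first-round actions. -/
lemma clsGLS_of_continuation {K : Type*} [Fintype K] (c : A₁ → A₂ → K → X × A₂)
    (hc : ∀ a b i, c a b i ∈ clsNash ι u₁ u₂) (hne : (clsNash ι u₁ u₂).Nonempty)
    (x : X) (b : A₂) (hx : (x, b) ∉ clsNash ι u₁ u₂)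
    (h₁ : ∀ y, (ι y).expect (fun a => u₁ a b + ∑ i, clsPay ι u₁ (c a b i)) ≤
      (ι x).expect fun a => u₁ a b + ∑ i, clsPay ι u₁ (c a b i))
    (h₂ : ∀ b', (ι x).expect (fun a => u₂ a b' + ∑ i, clsPay ι u₂ (c a b' i)) ≤
      (ι x).expect fun a => u₂ a b + ∑ i, clsPay ι u₂ (c a b i)) :
    clsGLS ι u₁ u₂ := by
  obtain ⟨q₀, hq₀⟩ := hne
  let e := Fintype.equivFin K
  let c' : A₁ × A₂ → ℕ → X × A₂ := fun p j =>
    if hj : j < Fintype.card K then c p.1 p.2 (e.symm ⟨j, hj⟩) else q₀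
  have hc' : ∀ p j, c' p j ∈ clsNash ι u₁ u₂ := by
    intro p j
    by_cases hj : j < Fintype.card K
    · simpa [c', hj] using hc _ _ _
    · simpa [c', hj] using hq₀
  have hsum : ∀ (u : A₁ → A₂ → ℝ) a b,
      ∑ j ∈ Finset.range (Fintype.card K), clsPay ι u (c' (a, b) j) =
        ∑ i, clsPay ι u (c a b i) := by
    intro u a b
    rw [Finset.sum_range, ← e.symm.sum_comp]
    simp [c']
  let μ : Hist A₁ A₂ → X × A₂ := fun h =>
    match h with
    | [] => (x, b)
    | p :: t => c' p t.length
  have htot : ∀ (u : A₁ → A₂ → ℝ) (k : ℕ) (p : A₁ × A₂) (t : Hist A₁ A₂),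
      clsTot ι u (fun h => (μ h).1) (fun h => (μ h).2) k (p :: t) =
        ∑ j ∈ Finset.range k, clsPay ι u (c' p (t.length + j)) := by
    intro u k p
    induction k with
    | zero => intro t; simp [clsTot, totPay]
    | succ k ih =>
      intro t
      rw [clsTot_succ]
      simp only [List.cons_append, ih, List.length_append, List.length_singleton]
      rw [Mix.expect_add_const, ← clsPay_eq_expect, Finset.sum_range_succ',
        add_comm]
      simp [μ, add_comm, add_left_comm]
  refine ⟨Fintype.card K + 1, by omega, fun h => (μ h).1, fun h => (μ h).2, ?_, [], by simp, hx⟩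
  rw [clsSPE_iff_oneShot]
  rintro (_ | ⟨p, t⟩) k hk
  · obtain rfl : k = Fintype.card K := by simpa using hk
    simp only [OneShot, List.nil_append, htot, List.length_nil, zero_add, hsum]
    exact ⟨h₁, h₂⟩
  · simp only [OneShot, List.cons_append, htot, List.length_append, List.length_singleton,
      Mix.expect_add_const]
    have := hc' p t.length
    simp only [clsNash, Set.mem_ofPred_eq, clsPay] at this
    simp only [expPay_pure_right_s10] at this
    exact ⟨fun y => add_le_add_left (this.1 y) _, fun b => add_le_add_left (this.2 b) _⟩

lemma exists_lt_of_nontrivial_image {α : Type*} {f : α → ℝ} {S : Set α}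
    (h : (f '' S).Nontrivial) : ∃ q ∈ S, ∃ q' ∈ S, f q < f q' := by
  obtain ⟨_, ⟨q, hq, rfl⟩, _, ⟨q', hq', rfl⟩, hlt⟩ := h.exists_lt
  exact ⟨q, hq, q', hq', hlt⟩

lemma exists_pure_notMem_clsNash (hι : ∀ a, ∃ x, ι x = Mix.pure a) {x : X} {b : A₂}
    (hx : (x, b) ∉ clsNash ι u₁ u₂) :
    ∃ x' a b', ι x' = Mix.pure a ∧ (x', b') ∉ clsNash ι u₁ u₂ := by
  by_contra! hc
  have all : ∀ a b, (∀ a', u₁ a' b ≤ u₁ a b) ∧ ∀ b', u₂ a b' ≤ u₂ a b := by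
    intro a b
    obtain ⟨y, hy⟩ := hι a
    obtain ⟨h₁, h₂⟩ := hc y a b hy
    refine ⟨fun a' => ?_, fun b' => ?_⟩
    · obtain ⟨z, hz⟩ := hι a'
      simpa [clsPay_of_eq_pure hy, clsPay_of_eq_pure hz] using h₁ z
    · simpa [clsPay_of_eq_pure hy] using h₂ b'
  refine hx ⟨fun y => ?_, fun b' => ?_⟩
  · simp only [clsPay_eq_expect]
    obtain ⟨a, -⟩ := (ι x).support_nonempty
    rw [(ι x).expect_eq_of_support (c := u₁ a b) fun a' _ =>
      le_antisymm ((all a b).1 a') ((all a' b).1 a)]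
    exact Mix.expect_le _ fun a' => (all a b).1 a'
  · simp only [clsPay_eq_expect]
    exact Mix.expect_mono _ fun a => (all a b).2 b'

/-- Both players can be rewarded and punished, so any pure profile can be supported. -/
lemma clsGLS_of_nontrivial_nontrivial (hι : ∀ a, ∃ x, ι x = Mix.pure a)
    (hV₁ : (clsPay ι u₁ '' clsNash ι u₁ u₂).Nontrivial)
    (hV₂ : (clsPay ι u₂ '' clsNash ι u₁ u₂).Nontrivial)
    {x : X} {b : A₂} (hx : (x, b) ∉ clsNash ι u₁ u₂) : clsGLS ι u₁ u₂ := by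
  obtain ⟨x, a, b, hxa, hx⟩ := exists_pure_notMem_clsNash hι hx
  obtain ⟨p, hp, p', hp', hpp⟩ := exists_lt_of_nontrivial_image hV₁
  obtain ⟨q, hq, q', hq', hqq⟩ := exists_lt_of_nontrivial_image hV₂
  obtain ⟨N, hN⟩ := exists_nat_forall_sub_le (fun a => u₁ a b) (sub_pos.2 hpp)
  obtain ⟨M, hM⟩ := exists_nat_forall_sub_le (u₂ a) (sub_pos.2 hqq)
  refine clsGLS_of_continuation (K := Fin N ⊕ Fin M)
    (fun a' b' => Sum.elim (fun _ => if a' = a then p' else p)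
      (fun _ => if b' = b then q' else q)) ?_ ⟨p, hp⟩ x b hx ?_ ?_
  · rintro a' b' (i | i) <;> simp only [Sum.elim_inl, Sum.elim_inr] <;> split_ifs <;> assumption
  · intro y
    rw [hxa, Mix.expect_pure]
    refine Mix.expect_le _ fun a' => ?_
    by_cases ha : a' = a
    · simp [ha]
    · simp [ha]
      linarith [hN a' a]
  · intro b'
    rw [hxa, Mix.expect_pure, Mix.expect_pure]
    by_cases hb : b' = b
    · simp [hb]
    · simp [hb]
      linarith [hM b' b]

/-- Player 2 can be rewarded and punished, so any best response of player 1 can be supported. -/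
lemma clsGLS_of_nontrivial_right
    (hV₂ : (clsPay ι u₂ '' clsNash ι u₁ u₂).Nontrivial)
    {x : X} {b b' : A₂} (hb : clsPay ι u₂ (x, b) < clsPay ι u₂ (x, b'))
    (hx : ∀ y, clsPay ι u₁ (y, b) ≤ clsPay ι u₁ (x, b)) : clsGLS ι u₁ u₂ := by
  obtain ⟨q, hq, q', hq', hqq⟩ := exists_lt_of_nontrivial_image hV₂
  obtain ⟨M, hM⟩ := exists_nat_forall_sub_le (fun b => clsPay ι u₂ (x, b)) (sub_pos.2 hqq)
  have hc : ∀ c, (if c = b then q' else q) ∈ clsNash ι u₁ u₂ := by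
    intro c; split_ifs <;> assumption
  refine clsGLS_of_continuation (K := Fin M) (fun _ c _ => if c = b then q' else q)
    (fun _ c _ => hc c) ⟨q, hq⟩ x b (fun h => (h.2 b').not_gt hb) ?_ ?_
  · intro y
    simp only [Mix.expect_add_const]
    have := hx y
    simp only [clsPay_eq_expect] at this
    linarith
  · intro c
    simp only [Mix.expect_add_const, ← clsPay_eq_expect]
    by_cases hcb : c = b
    · simp [hcb]
    · simp [hcb]
      linarith [hM c b]

/-- Player 1 can be rewarded, punished, and kept indifferent on the support of `x`, while
player 2's equilibrium payoff is constant. -/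
lemma clsGLS_of_nontrivial_oneVal (hι : ∀ a, ∃ x, ι x = Mix.pure a)
    (hV₁ : (clsPay ι u₁ '' clsNash ι u₁ u₂).Nontrivial)
    (hV₂ : oneVal (clsPay ι u₂ '' clsNash ι u₁ u₂))
    {x : X} {a' : A₁} {b : A₂} (ha' : clsPay ι u₁ (x, b) < u₁ a' b)
    (hb : ∀ b', clsPay ι u₂ (x, b') ≤ clsPay ι u₂ (x, b))
    (hD : (ι x).support.Nontrivial → ∃ a ∈ (ι x).support, ∀ a' ∈ (ι x).support, a' ≠ a →
      sumOfD (clsDiff ι u₁ u₂) (u₁ a b - u₁ a' b)) : clsGLS ι u₁ u₂ := by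
  classical
  obtain ⟨v, hv⟩ := hV₂
  have hv' : ∀ q ∈ clsNash ι u₁ u₂, clsPay ι u₂ q = v := fun q hq =>
    (hv ▸ Set.mem_image_of_mem (clsPay ι u₂) hq : _ ∈ ({v} : Set ℝ))
  obtain ⟨p, hp, p', hp', hpp⟩ := exists_lt_of_nontrivial_image hV₁
  have hx : (x, b) ∉ clsNash ι u₁ u₂ := by
    intro h
    obtain ⟨y, hy⟩ := hι a'
    have := h.1 y
    rw [clsPay_of_eq_pure hy] at this
    exact this.not_gt ha'
  obtain ⟨a₀, ha₀, hD⟩ : ∃ a ∈ (ι x).support, ∀ a' ∈ (ι x).support, a' ≠ a →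
      sumOfD (clsDiff ι u₁ u₂) (u₁ a b - u₁ a' b) := by
    by_cases hn : (ι x).support.Nontrivial
    · exact hD hn
    · obtain ⟨a, ha⟩ := (ι x).support_nonempty
      exact ⟨a, ha, fun c hc hca => absurd (Set.not_nontrivial_iff.1 hn hc ha) hca⟩
  have hq : ∀ a, ∃ (n : ℕ) (q q' : Fin n → X × A₂), (∀ i, q i ∈ clsNash ι u₁ u₂) ∧
      (∀ i, q' i ∈ clsNash ι u₁ u₂) ∧ (a ∈ (ι x).support →
        u₁ a₀ b - u₁ a b = ∑ i, (clsPay ι u₁ (q i) - clsPay ι u₁ (q' i))) := by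
    intro a
    by_cases ha : a ∈ (ι x).support ∧ a ≠ a₀
    · obtain ⟨n, d, hd, hs⟩ := hD a ha.1 ha.2
      choose q hq q' hq' hdq using hd
      exact ⟨n, q, q', hq, hq', fun _ => by rw [hs]; exact Finset.sum_congr rfl fun i _ => hdq i⟩
    · refine ⟨0, Fin.elim0, Fin.elim0, fun i => i.elim0, fun i => i.elim0, fun h => ?_⟩
      obtain rfl : a = a₀ := by by_contra hne; exact ha ⟨h, hne⟩
      simp
  choose n q q' hq hq' hs using hq
  set s : A₁ → ℝ := fun a => ∑ i, (clsPay ι u₁ (q a i) - clsPay ι u₁ (q' a i)) with hsdef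
  obtain ⟨N, hN⟩ := exists_nat_forall_sub_le (fun a => u₁ a b + s a) (sub_pos.2 hpp)
  let c : A₁ → A₂ → ((Σ a, Fin (n a)) ⊕ Fin N) → X × A₂ := fun a _ =>
    Sum.elim (fun i => if i.1 = a then q i.1 i.2 else q' i.1 i.2)
      (fun _ => if a ∈ (ι x).support then p' else p)
  have hc : ∀ a b i, c a b i ∈ clsNash ι u₁ u₂ := by
    rintro a b (i | i) <;> simp only [c, Sum.elim_inl, Sum.elim_inr] <;> split_ifs <;> simp [*]
  set B : ℝ := ∑ a, ∑ i, clsPay ι u₁ (q' a i) with hB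
  have hsum : ∀ a, u₁ a b + ∑ i, clsPay ι u₁ (c a b i) =
      u₁ a b + s a + B + N * clsPay ι u₁ (if a ∈ (ι x).support then p' else p) := by
    intro a
    have : ∑ a', ∑ i, clsPay ι u₁ (if a' = a then q a' i else q' a' i) = s a + B := by
      rw [← sub_eq_iff_eq_add, hB, ← Finset.sum_sub_distrib, Finset.sum_eq_single a]
      · simp [hsdef, Finset.sum_sub_distrib]
      · intro a' _ hne; simp [hne]
      · simp
    rw [Fintype.sum_sum_type, Fintype.sum_sigma]
    simp only [c, Sum.elim_inl, Sum.elim_inr, this, Finset.sum_const, Finset.card_univ,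
      Fintype.card_fin, nsmul_eq_mul]
    ring
  have hsupp : ∀ a ∈ (ι x).support, u₁ a b + s a = u₁ a₀ b := fun a ha => by
    have := hs a ha
    simp only [hsdef]
    linarith
  refine clsGLS_of_continuation c hc ⟨p, hp⟩ x b hx ?_ ?_
  · intro y
    simp only [hsum]
    rw [(ι x).expect_eq_of_support (c := u₁ a₀ b + B + N * clsPay ι u₁ p') fun a ha => by
      rw [hsupp a ha, if_pos ha]]
    refine Mix.expect_le _ fun a => ?_
    by_cases ha : a ∈ (ι x).support
    · rw [hsupp a ha, if_pos ha]
    · rw [if_neg ha]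
      have := hN a a₀
      simp only [hsupp a₀ ha₀] at this
      linarith
  · intro b'
    simp only [hv' _ (hc _ _ _), Mix.expect_add_const]
    have := hb b'
    simp only [clsPay_eq_expect] at this
    linarith

/-- Characterization of local suboptimality for a class of strategies containing the pure ones. -/
theorem clsGLS_iff_clsCond [Nonempty A₁] [Nonempty A₂] (hι : ∀ a, ∃ x, ι x = Mix.pure a) :
    clsGLS ι u₁ u₂ ↔ clsCond ι u₁ u₂ := by
  refine ⟨clsCond_of_clsGLS hι, ?_⟩
  rintro (⟨h₁, h₂, x, b, hx⟩ | ⟨h₁, h₂, x, a', b, ha', hb, hD⟩ | ⟨-, h₂, x, b, b', hb, hx⟩)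
  · exact clsGLS_of_nontrivial_nontrivial hι h₁ h₂ hx
  · exact clsGLS_of_nontrivial_oneVal hι h₁ h₂ ha' hb hD
  · exact clsGLS_of_nontrivial_right h₂ hb hx

/-! ### The pure-pure and mixed-pure cases -/

lemma clsNash_id (u₁ u₂ : A₁ → A₂ → ℝ) :
    clsNash (fun σ : Mix A₁ => σ) u₁ u₂ = NashMP u₁ u₂ := rfl

theorem GLSmp_iff_condMP [Nonempty A₁] [Nonempty A₂] (u₁ u₂ : A₁ → A₂ → ℝ) :
    GLSmp u₁ u₂ ↔ condMP u₁ u₂ :=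
  clsGLS_iff_clsCond (ι := fun σ : Mix A₁ => σ) fun a => ⟨Mix.pure a, rfl⟩

lemma clsPay_pure (u : A₁ → A₂ → ℝ) (q : A₁ × A₂) : clsPay Mix.pure u q = u q.1 q.2 :=
  expPay_pure_pure u q.1 q.2

lemma clsNash_pure (u₁ u₂ : A₁ → A₂ → ℝ) : clsNash Mix.pure u₁ u₂ = NashPP u₁ u₂ := by
  simp [clsNash, NashPP, clsPay_pure, BR1p, BR2p]

theorem GLSpp_iff_condPP [Nonempty A₁] [Nonempty A₂] (u₁ u₂ : A₁ → A₂ → ℝ) :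
    GLSpp u₁ u₂ ↔ condPP u₁ u₂ := by
  have h : GLSpp u₁ u₂ ↔ clsGLS Mix.pure u₁ u₂ := by
    unfold clsGLS
    rw [clsNash_pure]
    rfl
  rw [h, clsGLS_iff_clsCond fun a => ⟨a, rfl⟩]
  simp only [clsCond, clsNash_pure, Mix.support_pure, Set.not_nontrivial_singleton,
    false_imp_iff, and_true, funext (clsPay_pure _)]
  rfl

lemma br1p_of_br1m {u : A₁ → A₂ → ℝ} {σ : Mix A₁} {b : A₂} (h : BR1m u σ (Mix.pure b))
    {a : A₁} (ha : a ∈ σ.support) : BR1p u a b ∧ u a b = expPay u σ (Mix.pure b) := by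
  have hle : ∀ a', u a' b ≤ expPay u σ (Mix.pure b) := fun a' => by
    simpa [expPay_pure_pure] using h (Mix.pure a')
  have e : u a b = expPay u σ (Mix.pure b) := by
    rw [expPay_pure_right_s10] at hle ⊢
    exact σ.eq_expect_of_mem_support hle ha
  exact ⟨fun a' => e ▸ hle a', e⟩

lemma pure_mem_nashMP {u₁ u₂ : A₁ → A₂ → ℝ} {q : A₁ × A₂} (hq : q ∈ NashPP u₁ u₂) :
    (Mix.pure q.1, q.2) ∈ NashMP u₁ u₂ := by
  refine ⟨fun τ => ?_, fun b => ?_⟩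
  · rw [expPay_pure_pure, expPay_pure_right_s10]
    exact Mix.expect_le _ hq.1
  · simpa [expPay_pure_pure] using hq.2 b

lemma V1pp_subset_V1mp (u₁ u₂ : A₁ → A₂ → ℝ) : V1pp u₁ u₂ ⊆ V1mp u₁ u₂ := by
  rintro _ ⟨q, hq, rfl⟩
  exact ⟨_, pure_mem_nashMP hq, expPay_pure_pure _ _ _⟩

lemma V2pp_subset_V2mp (u₁ u₂ : A₁ → A₂ → ℝ) : V2pp u₁ u₂ ⊆ V2mp u₁ u₂ := by
  rintro _ ⟨q, hq, rfl⟩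
  exact ⟨_, pure_mem_nashMP hq, expPay_pure_pure _ _ _⟩

lemma not_oneVal_of_nontrivial {V : Set ℝ} (h : V.Nontrivial) : ¬ oneVal V := by
  rintro ⟨v, rfl⟩
  exact Set.not_nontrivial_singleton h

lemma not_condMP_of_nontrivial_nontrivial {u₁ u₂ : A₁ → A₂ → ℝ} (h₁ : (V1pp u₁ u₂).Nontrivial)
    (h₂ : (V2pp u₁ u₂).Nontrivial) (h : ¬ condPP u₁ u₂) : ¬ condMP u₁ u₂ := by
  rintro (⟨-, -, σ, b, hσ⟩ | ⟨-, h', -⟩ | ⟨h', -⟩)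
  · rw [← clsNash_id] at hσ
    obtain ⟨x, a, b', hxa, hx⟩ := exists_pure_notMem_clsNash (fun a => ⟨Mix.pure a, rfl⟩) hσ
    rw [clsNash_id] at hx
    subst hxa
    exact h (Or.inl ⟨h₁, h₂, a, b', fun hab => hx (pure_mem_nashMP (q := (a, b')) hab)⟩)
  · exact not_oneVal_of_nontrivial (h₂.mono (V2pp_subset_V2mp u₁ u₂)) h'
  · exact not_oneVal_of_nontrivial (h₁.mono (V1pp_subset_V1mp u₁ u₂)) h'

lemma not_condMP_of_oneVal_nontrivial {u₁ u₂ : A₁ → A₂ → ℝ} (h₁ : oneVal (V1pp u₁ u₂))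
    (h₂ : (V2pp u₁ u₂).Nontrivial) (h : ¬ condPP u₁ u₂) : ¬ condMP u₁ u₂ := by
  have hbr : ∀ a b, BR1p u₁ a b → BR2p u₂ a b := fun a b hab b' =>
    not_lt.1 fun hlt => h (Or.inr (Or.inr ⟨h₁, h₂, a, b, b', hlt, hab⟩))
  obtain ⟨v, hv⟩ := h₁
  have hV₁ : ¬ (V1mp u₁ u₂).Nontrivial := by
    rw [Set.not_nontrivial_iff]
    refine Set.subsingleton_of_subset_singleton (a := v) ?_
    rintro _ ⟨⟨σ, b⟩, hq, rfl⟩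
    obtain ⟨a, ha⟩ := σ.support_nonempty
    obtain ⟨hab, e⟩ := br1p_of_br1m hq.1 ha
    rw [← hv]
    exact ⟨(a, b), ⟨hab, hbr a b hab⟩, e⟩
  rintro (⟨h', -⟩ | ⟨h', -⟩ | ⟨-, -, σ, b, b', hlt, hσ⟩)
  · exact hV₁ h'
  · exact hV₁ h'
  · refine hlt.not_ge ?_
    rw [expPay_pure_right_s10, expPay_pure_right_s10]
    refine Finset.sum_le_sum fun a _ => ?_
    rcases (σ.nonneg a).eq_or_lt with h0 | h0
    · simp [← h0]
    · exact mul_le_mul_of_nonneg_left (hbr a b (br1p_of_br1m hσ h0).1 b') h0.le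

end StrategyClass

section TwoPlayer
variable {A₁ A₂ : Type*} [Fintype A₁] [Fintype A₂] [DecidableEq A₁] [DecidableEq A₂]
variable [Nonempty A₁] [Nonempty A₂]

/-- Characterization of `𝒢_LS^{m,p} \\ 𝒢_LS^{p,p}`. -/
theorem GLSmp_diff_GLSpp_iff (u₁ u₂ : A₁ → A₂ → ℝ) :
    (¬ GLSpp u₁ u₂ ∧ GLSmp u₁ u₂) ↔
      ((V1pp u₁ u₂ = ∅ ∧ V2pp u₁ u₂ = ∅ ∧ condMP u₁ u₂) ∨
       (oneVal (V1pp u₁ u₂) ∧ oneVal (V2pp u₁ u₂) ∧ condMP u₁ u₂) ∨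
       ((V1pp u₁ u₂).Nontrivial ∧ oneVal (V2pp u₁ u₂) ∧
         (¬ ∃ (a₁ a₁' : A₁) (a₂ : A₂), u₁ a₁ a₂ < u₁ a₁' a₂ ∧ BR2p u₂ a₁ a₂) ∧
         condMP u₁ u₂)) := by
  rw [GLSpp_iff_condPP, GLSmp_iff_condMP]
  have hcases : ∀ V : Set ℝ, V = ∅ ∨ oneVal V ∨ V.Nontrivial := fun V =>
    V.eq_empty_or_nonempty.imp_right Set.Nonempty.exists_eq_singleton_or_nontrivial
  have hempty : V1pp u₁ u₂ = ∅ ↔ V2pp u₁ u₂ = ∅ := by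
    simp [V1pp, V2pp, Set.image_eq_empty]
  have one_ne : ∀ {V : Set ℝ}, oneVal V → V ≠ ∅ := by
    rintro _ ⟨v, rfl⟩
    exact Set.singleton_ne_empty v
  have nontriv_ne : ∀ {V : Set ℝ}, V.Nontrivial → V ≠ ∅ := fun h => h.nonempty.ne_empty
  constructor
  · rintro ⟨hpp, hmp⟩
    rcases hcases (V1pp u₁ u₂) with h₁ | h₁ | h₁
    · exact Or.inl ⟨h₁, hempty.1 h₁, hmp⟩
    · rcases hcases (V2pp u₁ u₂) with h₂ | h₂ | h₂
      · exact absurd (hempty.2 h₂) (one_ne h₁)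
      · exact Or.inr (Or.inl ⟨h₁, h₂, hmp⟩)
      · exact absurd hmp (not_condMP_of_oneVal_nontrivial h₁ h₂ hpp)
    · rcases hcases (V2pp u₁ u₂) with h₂ | h₂ | h₂
      · exact absurd (hempty.2 h₂) (nontriv_ne h₁)
      · exact Or.inr (Or.inr ⟨h₁, h₂, fun hex => hpp (Or.inr (Or.inl ⟨h₁, h₂, hex⟩)), hmp⟩)
      · exact absurd hmp (not_condMP_of_nontrivial_nontrivial h₁ h₂ hpp)
  · rintro (⟨h₁, h₂, hmp⟩ | ⟨h₁, h₂, hmp⟩ | ⟨h₁, h₂, hno, hmp⟩)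
    · refine ⟨?_, hmp⟩
      rintro (⟨h, -⟩ | ⟨h, -⟩ | ⟨-, h, -⟩)
      exacts [nontriv_ne h h₁, nontriv_ne h h₁, nontriv_ne h h₂]
    · refine ⟨?_, hmp⟩
      rintro (⟨h, -⟩ | ⟨h, -⟩ | ⟨-, h, -⟩)
      exacts [not_oneVal_of_nontrivial h h₁, not_oneVal_of_nontrivial h h₁,
        not_oneVal_of_nontrivial h h₂]
    · refine ⟨?_, hmp⟩
      rintro (⟨-, h, -⟩ | ⟨-, -, h⟩ | ⟨-, h, -⟩)
      exacts [not_oneVal_of_nontrivial h h₂, hno h, not_oneVal_of_nontrivial h h₂]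

end TwoPlayer
end

section
/- 𝒢_LS^{m,p} ⊆ 𝒢_LS^{m,m}: for every 2-player stage game G, if there exist some T ≥ 1 and some subgame-perfect equilibrium of G(T) in which local suboptimality occurs when player 1 may use mixed strategies and player 2 is restricted to pure strategies, then there exist some T ≥ 1 and some subgame-perfect equilibrium of G(T) in which local suboptimality occurs when both players may use mixed strategies. -/
open Finset

section BackwardInduction

variable {A₁ A₂ : Type*} [Fintype A₁] [Fintype A₂]

/-- Expected total payoff over the remaining rounds when player 2 plays `a₂` now, given the
continuation values `w`. -/
def currentPay (u : A₁ → A₂ → ℝ) (σ₁ : Mix A₁) (w : A₁ → A₂ → ℝ) (a₂ : A₂) : ℝ :=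
  ∑ a₁, σ₁.p a₁ * (u a₁ a₂ + w a₁ a₂)

theorem totPay_succ (u : A₁ → A₂ → ℝ) (μ₁ : Hist A₁ A₂ → Mix A₁) (μ₂ : Hist A₁ A₂ → Mix A₂)
    (n : ℕ) (h : Hist A₁ A₂) :
    totPay u μ₁ μ₂ (n + 1) h = ∑ a₂, (μ₂ h).p a₂ *
      currentPay u (μ₁ h) (fun a₁ a₂ => totPay u μ₁ μ₂ n (h ++ [(a₁, a₂)])) a₂ := by
  rw [totPay, sum_comm]
  refine sum_congr rfl fun a₂ _ => ?_
  rw [currentPay, mul_sum]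
  exact sum_congr rfl fun a₁ _ => by ring

variable [Nonempty A₂]

/-- The optimal total payoff of player 2 against `μ₁`, by backward induction. -/
noncomputable def optPay (u : A₁ → A₂ → ℝ) (μ₁ : Hist A₁ A₂ → Mix A₁) :
    ℕ → Hist A₁ A₂ → ℝ
  | 0, _ => 0
  | n + 1, h => univ.sup' univ_nonempty
      (currentPay u (μ₁ h) fun a₁ a₂ => optPay u μ₁ n (h ++ [(a₁, a₂)]))

theorem totPay_le_optPay (u : A₁ → A₂ → ℝ) (μ₁ : Hist A₁ A₂ → Mix A₁)
    (μ₂ : Hist A₁ A₂ → Mix A₂) (n : ℕ) (h : Hist A₁ A₂) :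
    totPay u μ₁ μ₂ n h ≤ optPay u μ₁ n h := by
  induction n generalizing h with
  | zero => simp [totPay, optPay]
  | succ n ih =>
    rw [totPay_succ, ← one_mul (optPay u μ₁ (n + 1) h), ← (μ₂ h).sum_one, sum_mul]
    refine sum_le_sum fun a₂ _ => mul_le_mul_of_nonneg_left ?_ ((μ₂ h).nonneg a₂)
    refine le_trans (sum_le_sum fun a₁ _ => mul_le_mul_of_nonneg_left
      (add_le_add_right (ih _) _) ((μ₁ h).nonneg a₁)) ?_
    exact le_sup' (currentPay u (μ₁ h) fun a₁ a₂ => optPay u μ₁ n (h ++ [(a₁, a₂)]))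
      (mem_univ a₂)

variable [DecidableEq A₂]

/-- Some pure behavior strategy of player 2 attains the optimal total payoff. -/
theorem exists_pure_totPay_eq_optPay (u : A₁ → A₂ → ℝ) (μ₁ : Hist A₁ A₂ → Mix A₁) (T : ℕ) :
    ∃ μ₂ : Hist A₁ A₂ → A₂, ∀ n h, h.length + n = T →
      totPay u μ₁ (pureBeh2 μ₂) n h = optPay u μ₁ n h := by
  have hmax (h : Hist A₁ A₂) : ∃ b, ∀ n, h.length + (n + 1) = T → optPay u μ₁ (n + 1) h =
      currentPay u (μ₁ h) (fun a₁ a₂ => optPay u μ₁ n (h ++ [(a₁, a₂)])) b := by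
    obtain ⟨b, -, hb⟩ := exists_mem_eq_sup' univ_nonempty
      (currentPay u (μ₁ h) fun a₁ a₂ => optPay u μ₁ (T - h.length - 1) (h ++ [(a₁, a₂)]))
    refine ⟨b, fun n hn => ?_⟩
    obtain rfl : n = T - h.length - 1 := by omega
    exact hb
  choose μ₂ hμ₂ using hmax
  refine ⟨μ₂, fun n => ?_⟩
  induction n with
  | zero => simp [totPay, optPay]
  | succ n ih =>
    intro h hn
    rw [totPay_succ, hμ₂ h n hn]
    simp only [pureBeh2, Mix.pure, ite_mul, one_mul, zero_mul, sum_ite_eq', mem_univ, if_true]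
    refine sum_congr rfl fun a₁ _ => ?_
    exact congrArg (fun x => (μ₁ h).p a₁ * (u a₁ (μ₂ h) + x))
      (ih (h ++ [(a₁, μ₂ h)]) (by simp; omega))

/-- Allowing player 2 to mix does not destroy an equilibrium in which player 2 plays purely. -/
theorem isNEmp.isNEmm {u₁ u₂ : A₁ → A₂ → ℝ} {T : ℕ} {μ₁ : Hist A₁ A₂ → Mix A₁}
    {μ₂ : Hist A₁ A₂ → A₂} (h : isNEmp u₁ u₂ T μ₁ μ₂) :
    isNEmm u₁ u₂ T μ₁ (pureBeh2 μ₂) := by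
  refine ⟨h.1, fun μ₂' => (totPay_le_optPay u₂ μ₁ μ₂' T []).trans ?_⟩
  obtain ⟨ν, hν⟩ := exists_pure_totPay_eq_optPay u₂ μ₁ T
  exact (hν T [] (by simp)).ge.trans (h.2 ν)

end BackwardInduction

section TwoPlayer
variable {A₁ A₂ : Type*} [Fintype A₁] [Fintype A₂] [DecidableEq A₁] [DecidableEq A₂]
variable [Nonempty A₁] [Nonempty A₂]

/-- `𝒢_LS^{m,p} ⊆ 𝒢_LS^{m,m}`. -/
theorem GLSmp_subset_GLSmm (u₁ u₂ : A₁ → A₂ → ℝ) (h : GLSmp u₁ u₂) :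
    GLSmm u₁ u₂ := by
  obtain ⟨T, hT, μ₁, μ₂, hspe, k, hk, hloc⟩ := h
  exact ⟨T, hT, μ₁, pureBeh2 μ₂, fun k hk => (hspe k hk).isNEmm, k, hk,
    fun hN => hloc ⟨hN.1, fun b₂ => hN.2 (Mix.pure b₂)⟩⟩

end TwoPlayer
end
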